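/- arXiv:2412.16618 — 7 statements merged into one kernel-verified Lean document; each statement's English description precedes it below -/
import Mathlib

section
/- Let A be an integral domain. Then the following are equivalent: (i) for every prime ideal P of A, the localization A_P is a valuation ring (i.e., A is a Prüfer domain); (ii) every finitely generated ideal of A is projective as an A-module; (iii) every ideal of A is flat as an A-module. -/
universe u

section

variable {A : Type u} [CommRing A] [IsDomain A]

/-- If every finitely generated ideal of a domain is flat, then every localization at a prime is a
valuation ring. -/
theorem valuationRing_localizationAtPrime_of_flat
    (h : ∀ I : Ideal A, I.FG → Module.Flat A I) (P : Ideal A) [P.IsPrime] :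
    ValuationRing (Localization.AtPrime P) := by
  let B := Localization.AtPrime P
  have : IsBezout B := by
    refine ⟨fun J hJ ↦ ?_⟩
    obtain ⟨I, hI, rfl⟩ : ∃ I : Ideal A, I.FG ∧ I.map (algebraMap A B) = J := by
      obtain ⟨S, rfl⟩ := hJ
      have hsurj (x : B) : ∃ (a : A) (s : P.primeCompl),
          x * algebraMap A B s = algebraMap A B a :=
        have ⟨⟨a, s⟩, hs⟩ := IsLocalization.surj P.primeCompl x
        ⟨a, s, hs⟩
      choose a s hs using hsurj
      classical
      refine ⟨Ideal.span (S.image a), ⟨_, rfl⟩, ?_⟩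
      rw [Ideal.map_span]
      apply le_antisymm <;> rw [Ideal.span_le]
      · rintro _ ⟨y, hy, rfl⟩
        obtain ⟨x, hx, rfl⟩ := Finset.mem_image.mp hy
        rw [← hs x]
        exact Ideal.mul_mem_right _ _ (Ideal.subset_span hx)
      · intro x hx
        rw [SetLike.mem_coe,
          ← Ideal.mul_unit_mem_iff_mem _ (IsLocalization.map_units B (s x)), hs x]
        exact Ideal.subset_span ⟨_, Finset.mem_image_of_mem _ hx, rfl⟩
    have := h I hI
    have : Module.Flat B (I.map (algebraMap A B)) :=
      Module.Flat.of_isLocalizedModule B P.primeCompl (Algebra.idealMap B I)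
    have : Module.Finite B (I.map (algebraMap A B)) := Module.Finite.iff_fg.mpr (hI.map _)
    have : Module.Free B (I.map (algebraMap A B)) := Module.free_of_flat_of_isLocalRing
    rw [← Submodule.rank_le_one_iff_isPrincipal]
    exact (Submodule.rank_le _).trans (Module.rank_self B).le
  exact inferInstanceAs (ValuationRing B)

/-- A finitely generated ideal is locally generated by a single element at a prime whose local
ring is a valuation ring. -/
theorem Ideal.FG.exists_dvd_mul_of_valuationRing (P : Ideal A) [P.IsPrime]
    [ValuationRing (Localization.AtPrime P)] {I : Ideal A} (hI : I.FG) :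
    ∃ g ∈ I, ∃ s ∉ P, ∀ x ∈ I, g ∣ s * x := by
  have key : ∀ x y : A, algebraMap A (Localization.AtPrime P) x ∣ algebraMap A _ y →
      ∃ t ∉ P, x ∣ t * y := by
    rintro x y ⟨z, hz⟩
    obtain ⟨⟨c, t⟩, hc⟩ := IsLocalization.surj P.primeCompl z
    refine ⟨t, t.2, c, IsLocalization.injective (Localization.AtPrime P)
      P.primeCompl_le_nonZeroDivisors ?_⟩
    rw [map_mul, map_mul, hz, ← hc]
    ring
  have glue : ∀ (I₁ I₂ : Ideal A) (g₁ g₂ s₁ s₂ t : A), (∀ x ∈ I₁, g₁ ∣ s₁ * x) →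
      (∀ x ∈ I₂, g₂ ∣ s₂ * x) → g₁ ∣ t * g₂ → ∀ x ∈ I₁ ⊔ I₂, g₁ ∣ s₁ * s₂ * t * x := by
    intro I₁ I₂ g₁ g₂ s₁ s₂ t h₁ h₂ ht x hx
    obtain ⟨y, hy, z, hz, rfl⟩ := Submodule.mem_sup.mp hx
    have hy' : g₁ ∣ s₂ * t * (s₁ * y) := (h₁ y hy).mul_left _
    have hz' : g₁ ∣ s₁ * (t * (s₂ * z)) :=
      (ht.trans (mul_dvd_mul_left t (h₂ z hz))).mul_left _
    convert! dvd_add hy' hz' using 1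
    ring
  induction I, hI using Submodule.fg_induction with
  | singleton x =>
    refine ⟨x, Ideal.mem_span_singleton_self x, 1, P.one_notMem, fun y hy ↦ ?_⟩
    rw [one_mul]
    exact Ideal.mem_span_singleton.mp hy
  | sup I₁ I₂ _ _ h₁ h₂ =>
    obtain ⟨g₁, hg₁, s₁, hs₁, h₁⟩ := h₁
    obtain ⟨g₂, hg₂, s₂, hs₂, h₂⟩ := h₂
    have hP : P.IsPrime := inferInstance
    rcases ValuationRing.dvd_total (algebraMap A (Localization.AtPrime P) g₁)
      (algebraMap A _ g₂) with h | h
    · obtain ⟨t, ht, hd⟩ := key _ _ h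
      exact ⟨g₁, Ideal.mem_sup_left hg₁, s₁ * s₂ * t, by simp [hP.mul_mem_iff_mem_or_mem, *],
        glue _ _ _ _ _ _ _ h₁ h₂ hd⟩
    · obtain ⟨t, ht, hd⟩ := key _ _ h
      refine ⟨g₂, Ideal.mem_sup_right hg₂, s₂ * s₁ * t, by simp [hP.mul_mem_iff_mem_or_mem, *], ?_⟩
      rw [sup_comm]
      exact glue _ _ _ _ _ _ _ h₂ h₁ hd

/-- If all localizations of a domain at primes are valuation rings, then every finitely generated
ideal divides the principal ideals it contains. -/
theorem Ideal.FG.exists_mul_eq_span_singleton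
    (h : ∀ (P : Ideal A) [P.IsPrime], ValuationRing (Localization.AtPrime P))
    {I : Ideal A} (hI : I.FG) {a : A} (ha : a ∈ I) (ha0 : a ≠ 0) :
    ∃ J : Ideal A, I * J = Ideal.span {a} := by
  let J : Ideal A := (Ideal.span {a}).colon I
  have hJ : ∀ c, c ∈ J ↔ ∀ x ∈ I, a ∣ c * x := fun c ↦ by
    simp [J, Submodule.mem_colon, Ideal.mem_span_singleton]
  refine ⟨J, le_antisymm (Ideal.mul_le.mpr fun x hx c hc ↦ ?_) ?_⟩
  · rw [Ideal.mem_span_singleton, mul_comm]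
    exact (hJ c).mp hc x hx
  · suffices (I * J).colon {a} = ⊤ by
      rw [Ideal.span_singleton_le_iff_mem]
      simpa using Submodule.mem_colon_singleton.mp ((Ideal.eq_top_iff_one _).mp this)
    by_contra hne
    obtain ⟨P, hP, hle⟩ := Ideal.exists_le_maximal _ hne
    have hPp := hP.isPrime
    have := h P
    obtain ⟨g, hg, s, hs, hd⟩ := hI.exists_dvd_mul_of_valuationRing P
    refine hs (hle (Submodule.mem_colon_singleton.mpr ?_))
    obtain ⟨c, hc⟩ := hd a ha
    have hg0 : g ≠ 0 := by
      rintro rfl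
      have hs0 : s ≠ 0 := fun h0 ↦ hs (h0 ▸ P.zero_mem)
      simp [hs0, ha0] at hc
    rw [smul_eq_mul, hc]
    refine Ideal.mul_mem_mul hg ((hJ c).mpr fun x hx ↦ ?_)
    obtain ⟨d, hd⟩ := hd x hx
    exact ⟨d, mul_left_cancel₀ hg0 (by linear_combination (-x) * hc + a * hd)⟩

/-- An ideal of a domain that divides a nonzero principal ideal is projective. -/
theorem Ideal.projective_of_mul_eq_span_singleton {I J : Ideal A} {a : A} (ha : a ≠ 0)
    (h : I * J = Ideal.span {a}) : Module.Projective A I := by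
  let K := FractionRing A
  have ha' : algebraMap A K a ≠ 0 := by simpa using ha
  have hu : IsUnit (IsLocalization.coeSubmodule K I) := by
    refine IsUnit.of_mul_eq_one
      (IsLocalization.coeSubmodule K J * Submodule.span A {(algebraMap A K a)⁻¹}) ?_
    rw [← mul_assoc, ← IsLocalization.coeSubmodule_mul, h,
      IsLocalization.coeSubmodule_span_singleton, Submodule.span_mul_span,
      Set.singleton_mul_singleton, mul_inv_cancel₀ ha', Submodule.one_eq_span]
  have : Module.Projective A (Submodule.map (Algebra.linearMap A K) I) :=
    Submodule.projective_of_isUnit hu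
  exact Module.Projective.of_equiv (Submodule.equivMapOfInjective (Algebra.linearMap A K)
    (IsFractionRing.injective A K) I).symm

end

/-- For an integral domain `A`, the following are equivalent:
(i) `A` is a Prüfer domain (all localizations at primes are valuation rings);
(ii) every finitely generated ideal of `A` is projective;
(iii) every ideal of `A` is flat. -/
theorem stmt_0 (A : Type u) [CommRing A] [IsDomain A] :
    List.TFAE
      [∀ (P : Ideal A) [P.IsPrime], ValuationRing (Localization.AtPrime P),
       ∀ I : Ideal A, I.FG → Module.Projective A I,
       ∀ I : Ideal A, Module.Flat A I] := by
  tfae_have 1 → 2 := by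
    intro h I hI
    by_cases h0 : I = ⊥
    · subst h0
      infer_instance
    · obtain ⟨a, ha, ha0⟩ := Submodule.exists_mem_ne_zero_of_ne_bot h0
      obtain ⟨J, hJ⟩ := hI.exists_mul_eq_span_singleton h ha ha0
      exact Ideal.projective_of_mul_eq_span_singleton ha0 hJ
  tfae_have 2 → 1 := fun h ↦ valuationRing_localizationAtPrime_of_flat fun I hI ↦
    have := h I hI
    inferInstance
  tfae_have 1 → 3 := by
    intro h I
    rw [Module.Flat.flat_iff_torsion_eq_bot_of_valuationRing_localization_isMaximal
      fun P hP ↦ have := hP.isPrime; h P, ← Submodule.isTorsionFree_iff_torsion_eq_bot]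
    infer_instance
  tfae_have 3 → 1 := fun h ↦ valuationRing_localizationAtPrime_of_flat fun I _ ↦ h I
  tfae_finish
end

section
/- Let A be a commutative ring whose total quotient ring Q(A) (the localization of A at its set of non-zero-divisors) has Krull dimension 0. Then for every torsion-free A-module M and every prime ideal P of A, the localization M_P is a torsion-free module over A_P. -/
universe u v

/-- In a ring of Krull dimension at most `0`, the descending chain of powers of a principal ideal
stabilizes. -/
theorem exists_pow_mul_one_sub_mul_eq_zero {R : Type u} [CommRing R] [Ring.KrullDimLE 0 R]
    (x : R) : ∃ (n : ℕ) (y : R), x ^ n * (1 - x * y) = 0 := by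
  let S : Submonoid R :=
    { carrier := {z | ∃ (n : ℕ) (y : R), x ^ n * (1 - x * y) = z}
      one_mem' := ⟨0, 0, by simp⟩
      mul_mem' := by
        rintro _ _ ⟨n, y, rfl⟩ ⟨k, z, rfl⟩
        exact ⟨n + k, y + z - x * y * z, by ring⟩ }
  by_contra h
  have hdisj : Disjoint ((⊥ : Ideal R) : Set R) (S : Set R) := by
    rw [Set.disjoint_left]
    rintro z hz hzS
    obtain rfl : z = 0 := by simpa using hz
    exact h hzS
  obtain ⟨p, hp, -, hpS⟩ := Ideal.exists_le_prime_disjoint ⊥ S hdisj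
  have hmax : p.IsMaximal := Ideal.isMaximal_of_isPrime p
  have hx : x ∉ p := fun hx => Set.disjoint_left.mp hpS hx ⟨1, 0, by simp⟩
  obtain ⟨y, i, hi, hyi⟩ := hmax.exists_inv hx
  refine Set.disjoint_left.mp hpS hi ⟨0, y, ?_⟩
  linear_combination -hyi

/-- If the total quotient ring of `A` has Krull dimension at most `0`, then every `a : A` divides a
non-zero-divisor up to an element killed by a power of `a`. -/
theorem exists_pow_mul_sub_mul_eq_zero {A : Type u} [CommRing A]
    [Ring.KrullDimLE 0 (Localization (nonZeroDivisors A))] (a : A) :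
    ∃ (n : ℕ) (b : A), ∃ s ∈ nonZeroDivisors A, a ^ n * (s - a * b) = 0 := by
  obtain ⟨n, y, hy⟩ := exists_pow_mul_one_sub_mul_eq_zero
    (algebraMap A (Localization (nonZeroDivisors A)) a)
  obtain ⟨⟨b, s⟩, hbs⟩ := IsLocalization.surj (nonZeroDivisors A) y
  refine ⟨n, b, s, s.2, ?_⟩
  apply IsLocalization.injective (Localization (nonZeroDivisors A)) le_rfl
  simp only [map_mul, map_pow, map_sub, map_zero] at hbs ⊢
  rw [← hbs]
  linear_combination (algebraMap A (Localization (nonZeroDivisors A)) s) * hy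

/-- A fraction in a localized module vanishes iff its numerator is killed by a denominator. -/
theorem LocalizedModule.mk_eq_zero_iff {A : Type u} [CommRing A] {S : Submonoid A} {M : Type v}
    [AddCommGroup M] [Module A M] {m : M} {s : S} :
    LocalizedModule.mk m s = 0 ↔ ∃ u ∈ S, u • m = 0 := by
  rw [← LocalizedModule.zero_mk s, LocalizedModule.mk_eq]
  constructor
  · rintro ⟨u, hu⟩
    exact ⟨u * s, mul_mem u.2 s.2, by simpa [mul_smul, Submonoid.smul_def] using hu⟩
  · rintro ⟨u, hu, hum⟩
    exact ⟨⟨u, hu⟩, by rw [smul_comm]; simp [Submonoid.smul_def, hum]⟩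

/-- If the total quotient ring of `A` has Krull dimension `0`, then for every
torsion-free `A`-module `M` and every prime `P` of `A`, the localization `M_P`
is a torsion-free `A_P`-module. -/
theorem stmt_4 (A : Type u) [CommRing A]
    (hdim : ringKrullDim (Localization (nonZeroDivisors A)) = 0)
    (M : Type v) [AddCommGroup M] [Module A M]
    (hM : ∀ a ∈ nonZeroDivisors A, Function.Injective fun m : M => a • m)
    (P : Ideal A) [P.IsPrime] :
    ∀ a ∈ nonZeroDivisors (Localization.AtPrime P),
      Function.Injective fun m : LocalizedModule P.primeCompl M => a • m := by
  have : Ring.KrullDimLE 0 (Localization (nonZeroDivisors A)) :=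
    Ring.krullDimLE_iff.mpr hdim.le
  intro q hq
  obtain ⟨⟨a, w⟩, haw⟩ := IsLocalization.surj P.primeCompl q
  have ha : algebraMap A (Localization.AtPrime P) a ∈ nonZeroDivisors _ := by
    rw [← haw]
    exact mul_mem hq (IsLocalization.map_units _ w).mem_nonZeroDivisors
  obtain ⟨n, b, s, hs, hn⟩ := exists_pow_mul_sub_mul_eq_zero a
  have hloc : algebraMap A (Localization.AtPrime P) (s - a * b) = 0 := by
    have := congrArg (algebraMap A (Localization.AtPrime P)) hn
    rw [map_mul, map_pow, map_zero] at this
    exact (mul_left_mem_nonZeroDivisors_eq_zero_iff (pow_mem ha n)).mp this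
  obtain ⟨t, ht⟩ := (IsLocalization.map_eq_zero_iff P.primeCompl _ _).mp hloc
  refine (injective_iff_map_eq_zero
    (DistribSMul.toAddMonoidHom (LocalizedModule P.primeCompl M) q)).mpr fun x hx => ?_
  replace hx : q • x = 0 := hx
  induction x using LocalizedModule.induction_on with | _ m v
  have hax : a • LocalizedModule.mk m v = 0 := by
    rw [← algebraMap_smul (Localization.AtPrime P) a, ← haw, mul_comm, mul_smul, hx, smul_zero]
  rw [LocalizedModule.smul'_mk, LocalizedModule.mk_eq_zero_iff] at hax
  obtain ⟨u, hu, hum⟩ := hax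
  rw [LocalizedModule.mk_eq_zero_iff]
  refine ⟨t * u, mul_mem t.2 hu, hM s hs ?_⟩
  have hsm : s * (t * u) = t * b * (u * a) := by linear_combination u * ht
  simp only [smul_zero]
  rw [← mul_smul, hsm, mul_smul, mul_smul u, hum, smul_zero]
end

section
/- Let A be a semi-hereditary commutative ring and let P be a prime ideal of A such that every element of P is a zero divisor of A. Then P² = P. -/
universe u

/-- If the principal ideal generated by `a` is projective, then the annihilator of `a` is
generated by `1 - u` for some `u` (which is then idempotent). -/
theorem exists_mul_eq_self_of_projective_span_singleton {A : Type u} [CommRing A] (a : A)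
    [Module.Projective A (Ideal.span {a})] :
    ∃ u : A, u * a = a ∧ ∀ b : A, a * b = 0 → u * b = 0 := by
  have ha : a ∈ Ideal.span {a} := Ideal.mem_span_singleton_self a
  let f : A →ₗ[A] Ideal.span {a} := LinearMap.toSpanSingleton A _ ⟨a, ha⟩
  have hf : Function.Surjective f := by
    rintro ⟨x, hx⟩
    obtain ⟨c, rfl⟩ := Ideal.mem_span_singleton'.mp hx
    exact ⟨c, rfl⟩
  obtain ⟨s, hs⟩ := Module.projective_lifting_property f LinearMap.id hf
  refine ⟨s ⟨a, ha⟩, congrArg Subtype.val (LinearMap.congr_fun hs ⟨a, ha⟩), fun b hb => ?_⟩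
  have h : b • (⟨a, ha⟩ : Ideal.span {a}) = 0 := Subtype.ext ((mul_comm b a).trans hb)
  rw [mul_comm, ← smul_eq_mul, ← map_smul, h, map_zero]

/-- If `A` is semi-hereditary and `P` is a prime ideal all of whose elements are
zero divisors, then `P² = P`. -/
theorem stmt_9 (A : Type u) [CommRing A]
    (hsh : ∀ I : Ideal A, I.FG → Module.Projective A I)
    (P : Ideal A) (hP : P.IsPrime)
    (hzd : ∀ x ∈ P, ∃ b : A, b ≠ 0 ∧ x * b = 0) :
    P ^ 2 = P := by
  refine le_antisymm (Ideal.pow_le_self two_ne_zero) fun a ha => ?_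
  have := hsh (Ideal.span {a}) (Submodule.fg_span_singleton a)
  obtain ⟨u, hua, hann⟩ := exists_mul_eq_self_of_projective_span_singleton a
  have hu : u * (1 - u) = 0 := hann _ (by linear_combination -hua)
  rcases hP.mem_or_mem (hu ▸ P.zero_mem : u * (1 - u) ∈ P) with h | h
  · rw [← hua, pow_two]
    exact Ideal.mul_mem_mul h ha
  · obtain ⟨b, hb, hab⟩ := hzd _ (P.add_mem ha h)
    have hub : u * b = 0 := hann b (by linear_combination u * hab - b * hua - b * hu)
    have h_ab : a * b = 0 := by linear_combination a * hub - b * hua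
    exact absurd (by linear_combination hab - h_ab + hub) hb
end

section
/- Let A be a semi-hereditary commutative ring and let P be a finitely generated prime ideal of A such that every element of P is a zero divisor of A. Then there exists an idempotent element e ∈ P (e² = e) such that P = (e) is the principal ideal generated by e. -/
universe u

/-- The annihilator of a generator of a projective principal ideal is generated by an
idempotent. -/
theorem exists_idempotent_annihilator_of_projective {A : Type u} [CommRing A] (a : A)
    (h : Module.Projective A (Ideal.span {a})) :
    ∃ e : A, e * a = 0 ∧ ∀ x : A, x * a = 0 → x * e = x := by
  let y : Ideal.span {a} := ⟨a, Ideal.mem_span_singleton_self a⟩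
  have hsurj : Function.Surjective (LinearMap.toSpanSingleton A (Ideal.span {a}) y) := by
    rintro ⟨z, hz⟩
    obtain ⟨c, hc⟩ := Ideal.mem_span_singleton'.1 hz
    exact ⟨c, Subtype.ext hc⟩
  obtain ⟨s, hs⟩ := Module.projective_lifting_property _ LinearMap.id hsurj
  have hsy : s y * a = a := congrArg Subtype.val (LinearMap.congr_fun hs y)
  refine ⟨1 - s y, by linear_combination -hsy, fun x hx => ?_⟩
  have hxy : x • y = 0 := Subtype.ext hx
  have hxs : x * s y = 0 := by
    rw [← smul_eq_mul, ← map_smul, hxy, map_zero]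
  linear_combination -hxs

/-- If annihilators of elements are generated by idempotents, every finitely generated ideal
contains an element with the same annihilator. -/
theorem exists_mem_annihilating_of_fg {A : Type u} [CommRing A]
    (h : ∀ a : A, ∃ e : A, e * a = 0 ∧ ∀ x : A, x * a = 0 → x * e = x)
    (I : Ideal A) (hI : I.FG) :
    ∃ b ∈ I, ∀ x : A, x * b = 0 → ∀ p ∈ I, x * p = 0 := by
  induction I, hI using Submodule.fg_induction with
  | singleton a =>
    refine ⟨a, Ideal.mem_span_singleton_self a, fun x hx p hp => ?_⟩
    obtain ⟨c, rfl⟩ := Ideal.mem_span_singleton'.1 hp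
    linear_combination c * hx
  | sup I J _ _ hI hJ =>
    obtain ⟨a, ha, ha'⟩ := hI
    obtain ⟨c, hc, hc'⟩ := hJ
    obtain ⟨e, hea, he⟩ := h a
    refine ⟨a + e * c, Submodule.add_mem_sup ha (J.smul_mem e hc), fun x hx p hp => ?_⟩
    have hee := he e hea
    have hxec : x * e * c = 0 := by
      linear_combination e * hx - x * hea - x * c * hee
    have hxa : x * a = 0 := by linear_combination hx - hxec
    have hxc : x * c = 0 := by linear_combination hxec - c * he x hxa
    obtain ⟨i, hi, j, hj, rfl⟩ := Submodule.mem_sup.1 hp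
    rw [mul_add, ha' x hxa i hi, hc' x hxc j hj, add_zero]

/-- If `A` is semi-hereditary and `P` is a finitely generated prime ideal all of
whose elements are zero divisors, then `P` is generated by an idempotent. -/
theorem stmt_10 (A : Type u) [CommRing A]
    (hsh : ∀ I : Ideal A, I.FG → Module.Projective A I)
    (P : Ideal A) (hP : P.IsPrime) (hfg : P.FG)
    (hzd : ∀ x ∈ P, ∃ b : A, b ≠ 0 ∧ x * b = 0) :
    ∃ e ∈ P, IsIdempotentElem e ∧ P = Ideal.span {e} := by
  have h : ∀ a : A, ∃ e : A, e * a = 0 ∧ ∀ x : A, x * a = 0 → x * e = x := fun a =>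
    exists_idempotent_annihilator_of_projective a (hsh _ (Submodule.fg_span_singleton a))
  obtain ⟨b, hb, hbP⟩ := exists_mem_annihilating_of_fg h P hfg
  obtain ⟨f, hfb, hf⟩ := h b
  obtain ⟨c, hc, hbc⟩ := hzd b hb
  have hff : f * f = f := hf f hfb
  have hfP : f ∉ P := fun hmem => hc <| by
    have hf0 : f = 0 := hff.symm.trans (hbP f hfb f hmem)
    rw [← hf c (by rw [mul_comm, hbc]), hf0, mul_zero]
  have hmem : 1 - f ∈ P := by
    refine (hP.mem_or_mem (x := f) (y := 1 - f) ?_).resolve_left hfP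
    have h0 : f * (1 - f) = 0 := by linear_combination -hff
    exact h0 ▸ P.zero_mem
  refine ⟨1 - f, hmem, IsIdempotentElem.one_sub hff, le_antisymm (fun p hp => ?_) ?_⟩
  · exact Ideal.mem_span_singleton'.2 ⟨p, by linear_combination -hbP f hfb p hp⟩
  · exact (Ideal.span_singleton_le_iff_mem P).2 hmem
end

section
/- Let A be a semi-hereditary commutative ring and let P be a finitely generated prime ideal of A such that every element of P is a zero divisor of A, with P = (e) for an idempotent e ∈ A. Then the natural map A → A/eA × A/(1−e)A is a ring isomorphism, A/eA is a Prüfer domain, and A/(1−e)A is semi-hereditary. -/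
universe u

/-- A module over a quotient of `A` that is projective over `A` is projective over the quotient. -/
theorem Module.Projective.of_surjective_algebraMap {A B : Type u} [CommRing A] [CommRing B]
    [Algebra A B] (hs : Function.Surjective (algebraMap A B)) (M : Type u) [AddCommGroup M]
    [Module A M] [Module B M] [IsScalarTower A B M] [Module.Projective A M] :
    Module.Projective B M := by
  refine Module.Projective.of_lifting_property' fun {N Q} _ _ _ _ f g hf => ?_
  let : Module A N := Module.compHom N (algebraMap A B)
  let : Module A Q := Module.compHom Q (algebraMap A B)
  have : IsScalarTower A B N := IsScalarTower.of_algebraMap_smul fun _ _ => rfl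
  have : IsScalarTower A B Q := IsScalarTower.of_algebraMap_smul fun _ _ => rfl
  obtain ⟨h, hh⟩ := Module.projective_lifting_property (f.restrictScalars A)
    (g.restrictScalars A) hf
  exact ⟨h.extendScalarsOfSurjective hs, LinearMap.ext fun x => LinearMap.congr_fun hh x⟩

/-- A finitely generated ideal of `A ⧸ (e)`, with `e` idempotent, is the isomorphic image of a
finitely generated ideal of `A`. -/
theorem Ideal.exists_fg_linearEquiv_of_isIdempotentElem {A : Type u} [CommRing A] {e : A}
    (he : IsIdempotentElem e) (I : Ideal (A ⧸ Ideal.span {e})) (hI : I.FG) :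
    ∃ J : Ideal A, J.FG ∧ Nonempty (J ≃ₗ[A] I) := by
  have hmk : Function.Surjective (Ideal.Quotient.mk (Ideal.span {e})) :=
    Ideal.Quotient.mk_surjective
  have he0 : Ideal.Quotient.mk (Ideal.span {e}) e = 0 :=
    Ideal.Quotient.eq_zero_iff_mem.2 (Ideal.mem_span_singleton_self e)
  obtain ⟨s, rfl⟩ := hI
  let t : A ⧸ Ideal.span {e} → A := fun x => (1 - e) * Function.surjInv hmk x
  have ht : ∀ x, Ideal.Quotient.mk (Ideal.span {e}) (t x) = x := fun x => by
    simp [t, he0, Function.surjInv_eq hmk x]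
  let J : Ideal A := Ideal.span (t '' s)
  have hmap : J.map (Ideal.Quotient.mk (Ideal.span {e})) = Ideal.span (s : Set _) := by
    rw [Ideal.map_span, Set.image_image]
    simp only [ht, Set.image_id']
  have hJ : J ≤ Ideal.span {1 - e} := by
    rw [Ideal.span_le]
    rintro _ ⟨x, -, rfl⟩
    exact Ideal.mem_span_singleton.2 (dvd_mul_right _ _)
  let f : J →ₗ[A] (Ideal.span (s : Set (A ⧸ Ideal.span {e}))) :=
    { toFun := fun x => ⟨Ideal.Quotient.mk _ x.1, hmap ▸ Ideal.mem_map_of_mem _ x.2⟩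
      map_add' := fun _ _ => rfl
      map_smul' := fun _ _ => rfl }
  refine ⟨J, Submodule.fg_span (s.finite_toSet.image t), ⟨LinearEquiv.ofBijective f ⟨?_, ?_⟩⟩⟩
  · rw [injective_iff_map_eq_zero]
    rintro ⟨x, hx⟩ h
    have hx0 : Ideal.Quotient.mk (Ideal.span {e}) x = 0 := congrArg Subtype.val h
    obtain ⟨a, ha⟩ := Ideal.mem_span_singleton.1 (Ideal.Quotient.eq_zero_iff_mem.1 hx0)
    obtain ⟨b, hb⟩ := Ideal.mem_span_singleton.1 (hJ hx)
    have he' : e * e = e := he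
    refine Subtype.ext ?_
    change x = 0
    linear_combination (1 - e) * ha + e * hb - (a + b) * he'
  · rintro ⟨y, hy⟩
    obtain ⟨x, hx, rfl⟩ := (Ideal.mem_map_iff_of_surjective _ hmk).1 (hmap.symm ▸ hy)
    exact ⟨⟨x, hx⟩, rfl⟩

/-- The quotient of a semi-hereditary ring by an idempotent is semi-hereditary. -/
theorem Ideal.projective_quotient_of_isIdempotentElem {A : Type u} [CommRing A]
    (hsh : ∀ I : Ideal A, I.FG → Module.Projective A I) {e : A} (he : IsIdempotentElem e)
    (I : Ideal (A ⧸ Ideal.span {e})) (hI : I.FG) :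
    Module.Projective (A ⧸ Ideal.span {e}) I := by
  obtain ⟨J, hJ, ⟨φ⟩⟩ := Ideal.exists_fg_linearEquiv_of_isIdempotentElem he I hI
  have := hsh J hJ
  have : Module.Projective A I := Module.Projective.of_equiv φ
  exact Module.Projective.of_surjective_algebraMap (A := A) Ideal.Quotient.mk_surjective I

/-- The product decomposition of a ring attached to an idempotent. -/
theorem Ideal.bijective_quotient_prod_of_isIdempotentElem {A : Type u} [CommRing A] {e : A}
    (he : IsIdempotentElem e) :
    Function.Bijective ((Ideal.Quotient.mk (Ideal.span {e})).prod
      (Ideal.Quotient.mk (Ideal.span {1 - e}))) := by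
  have he' : e * e = e := he
  constructor
  · rw [injective_iff_map_eq_zero]
    intro x h
    obtain ⟨a, ha⟩ := Ideal.mem_span_singleton.1
      (Ideal.Quotient.eq_zero_iff_mem.1 (congrArg Prod.fst h))
    obtain ⟨b, hb⟩ := Ideal.mem_span_singleton.1
      (Ideal.Quotient.eq_zero_iff_mem.1 (congrArg Prod.snd h))
    linear_combination (1 - e) * ha + e * hb - (a + b) * he'
  · rintro ⟨y, z⟩
    obtain ⟨a, rfl⟩ := Ideal.Quotient.mk_surjective y
    obtain ⟨b, rfl⟩ := Ideal.Quotient.mk_surjective z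
    refine ⟨(1 - e) * a + e * b, Prod.ext ?_ ?_⟩
    · exact Ideal.Quotient.eq.2 (Ideal.mem_span_singleton.2 ⟨b - a, by ring⟩)
    · exact Ideal.Quotient.eq.2 (Ideal.mem_span_singleton.2 ⟨a - b, by ring⟩)

/-- Let `A` be semi-hereditary and `P = (e)` a finitely generated prime ideal,
generated by an idempotent `e`, all of whose elements are zero divisors.  Then the
natural map `A → A/eA × A/(1-e)A` is a ring isomorphism, `A/eA` is a Prüfer
domain (a domain all of whose finitely generated ideals are projective), and
`A/(1-e)A` is semi-hereditary. -/
theorem stmt_11 (A : Type u) [CommRing A]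
    (hsh : ∀ I : Ideal A, I.FG → Module.Projective A I)
    (P : Ideal A) (hP : P.IsPrime) (hfg : P.FG)
    (hzd : ∀ x ∈ P, ∃ b : A, b ≠ 0 ∧ x * b = 0)
    (e : A) (he : IsIdempotentElem e) (hPe : P = Ideal.span {e}) :
    Function.Bijective
        ((Ideal.Quotient.mk (Ideal.span {e})).prod
          (Ideal.Quotient.mk (Ideal.span {1 - e}))) ∧
      IsDomain (A ⧸ Ideal.span {e}) ∧
      (∀ I : Ideal (A ⧸ Ideal.span {e}), I.FG →
        Module.Projective (A ⧸ Ideal.span {e}) I) ∧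
      (∀ I : Ideal (A ⧸ Ideal.span {1 - e}), I.FG →
        Module.Projective (A ⧸ Ideal.span {1 - e}) I) := by
  subst hPe
  exact ⟨Ideal.bijective_quotient_prod_of_isIdempotentElem he,
    (Ideal.Quotient.isDomain_iff_prime _).2 hP,
    Ideal.projective_quotient_of_isIdempotentElem hsh he,
    Ideal.projective_quotient_of_isIdempotentElem hsh he.one_sub⟩
end

section
/- Let A be a semi-hereditary commutative ring in which every minimal prime ideal is finitely generated. Then A is isomorphic to a finite product of Prüfer domains. -/
universe u

/-- The annihilator of an element generating a projective ideal has a unit element. -/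
lemma exists_mul_eq_zero_and_mul_eq_self_of_projective {A : Type*} [CommRing A] (a : A)
    [Module.Projective A (Ideal.span {a})] :
    ∃ e : A, a * e = 0 ∧ ∀ x, a * x = 0 → e * x = x := by
  let g : A →ₗ[A] Ideal.span {a} :=
    LinearMap.toSpanSingleton A _ ⟨a, Ideal.mem_span_singleton_self a⟩
  have hg : Function.Surjective g := by
    rintro ⟨y, hy⟩
    obtain ⟨c, rfl⟩ := Ideal.mem_span_singleton'.mp hy
    exact ⟨c, Subtype.ext (by simp [g])⟩
  obtain ⟨s, hs⟩ := Module.projective_lifting_property g LinearMap.id hg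
  set t := s ⟨a, Ideal.mem_span_singleton_self a⟩ with ht
  have hta : t * a = a := by
    simpa [g] using congrArg Subtype.val
      (LinearMap.congr_fun hs ⟨a, Ideal.mem_span_singleton_self a⟩)
  refine ⟨1 - t, by linear_combination -hta, fun x hx ↦ ?_⟩
  have hxt : x * t = 0 := by
    rw [ht, ← smul_eq_mul, ← map_smul]
    convert map_zero s
    exact Subtype.ext (by simpa [mul_comm] using hx)
  linear_combination -hxt

/-- If all principal ideals are projective, then finitely generated minimal primes are generated
by idempotents. -/
lemma exists_isIdempotentElem_of_mem_minimalPrimes {A : Type*} [CommRing A]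
    (h : ∀ a : A, Module.Projective A (Ideal.span {a}))
    {P : Ideal A} (hP : P ∈ minimalPrimes A) (hfg : P.FG) :
    ∃ e : A, IsIdempotentElem e ∧ P = Ideal.span {1 - e} := by
  have hprime : P.IsPrime := hP.1.1
  have hidem : IsIdempotentElem P := by
    refine le_antisymm Ideal.mul_le_left fun x hx ↦ ?_
    obtain ⟨e, hxe, he⟩ := exists_mul_eq_zero_and_mul_eq_self_of_projective x
    have heP : e ∉ P := fun heP ↦ by
      refine notMem_nonZeroDivisors_of_mem_mem_minimalPrimes (P.add_mem hx heP) hP ?_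
      refine mem_nonZeroDivisors_iff_left.mpr fun y hy ↦ ?_
      have hey : e * y = 0 := by linear_combination e * hy - y * hxe - y * he e hxe
      rw [← he y (by linear_combination hy - hey), hey]
    have h1e : 1 - e ∈ P := (hprime.mem_or_mem (x := e) (y := 1 - e)
      (by rw [mul_sub, he e hxe, mul_one, sub_self]; exact P.zero_mem)).resolve_left heP
    have : (1 - e) * x = x := by linear_combination -hxe
    rw [← this]
    exact Ideal.mul_mem_mul h1e hx
  obtain ⟨f, hf, rfl⟩ := (P.isIdempotentElem_iff_of_fg hfg).mp hidem
  exact ⟨1 - f, hf.one_sub, by simp⟩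

/-- Projectivity of finitely generated ideals passes to quotients by idempotents. -/
lemma projective_ideal_quotient_of_isIdempotentElem {A : Type*} [CommRing A]
    (h : ∀ I : Ideal A, I.FG → Module.Projective A I) {e : A} (he : IsIdempotentElem e)
    (J : Ideal (A ⧸ Ideal.span {1 - e})) (hJ : J.FG) :
    Module.Projective (A ⧸ Ideal.span {1 - e}) J := by
  classical
  have : IsLocalization (Submonoid.powers e) (A ⧸ Ideal.span {1 - e}) :=
    IsLocalization.away_of_isIdempotentElem he Ideal.mk_ker Ideal.Quotient.mk_surjective
  obtain ⟨s, rfl⟩ := hJ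
  have hsurj := Ideal.Quotient.mk_surjective (I := Ideal.span {1 - e})
  let I : Ideal A := Ideal.span (s.image (Function.surjInv hsurj))
  have hI : I.localized' (A ⧸ Ideal.span {1 - e}) (Submonoid.powers e)
      (Algebra.linearMap A _) = Ideal.span (s : Set (A ⧸ Ideal.span {1 - e})) := by
    refine (Submodule.localized'_span _ _ _ _).trans ?_
    rw [Finset.coe_image, Set.image_image, Ideal.submodule_span_eq]
    congr 1
    convert Set.image_id _
    exact Function.surjInv_eq hsurj _
  have := h I ⟨_, rfl⟩
  rw [← hI]
  exact Module.projective_of_isLocalizedModule (Submonoid.powers e)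
    (I.toLocalized' (A ⧸ Ideal.span {1 - e}) (Submonoid.powers e) (Algebra.linearMap A _))

/-- If all minimal primes are generated by idempotents, then finitely many of them have
zero intersection. -/
lemma exists_finset_minimalPrimes_iInf_eq_bot {A : Type*} [CommRing A]
    (h : ∀ P ∈ minimalPrimes A, ∃ e : A, IsIdempotentElem e ∧ P = Ideal.span {1 - e}) :
    ∃ T : Finset (minimalPrimes A), ⨅ P : T, (P : Ideal A) = ⊥ := by
  choose! e he hPe using h
  have hzero {P} (hP : P ∈ minimalPrimes A) {x : A} (hx : x ∈ P) : x * e P = 0 := by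
    rw [hPe P hP] at hx
    obtain ⟨c, rfl⟩ := Ideal.mem_span_singleton'.mp hx
    linear_combination -c * (he P hP).eq
  have htop : ⨆ P : minimalPrimes A, Ideal.span {e P} = ⊤ := by
    by_contra hne
    obtain ⟨M, hM, hle⟩ := Ideal.exists_le_maximal _ hne
    obtain ⟨P, hP, hPM⟩ := Ideal.exists_minimalPrimes_le (bot_le : ⊥ ≤ M)
    have h₁ : e P ∈ M := hle (Ideal.mem_iSup_of_mem ⟨P, hP⟩ (Ideal.mem_span_singleton_self _))
    have h₂ : 1 - e P ∈ M :=
      hPM ((hPe P hP).symm.le (Ideal.mem_span_singleton_self (1 - e P)))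
    refine hM.ne_top ((Ideal.eq_top_iff_one M).mpr ?_)
    simpa using M.add_mem h₁ h₂
  have hone : (1 : A) ∈ ⨆ P : minimalPrimes A, Ideal.span {e P} := htop ▸ Submodule.mem_top
  obtain ⟨T, hT⟩ := Submodule.exists_finset_of_mem_iSup _ hone
  refine ⟨T, (Submodule.eq_bot_iff _).mpr fun x hx ↦ ?_⟩
  have hle : ⨆ P ∈ T, Ideal.span {e (P : Ideal A)} ≤ LinearMap.ker (LinearMap.mulLeft A x) :=
    iSup₂_le fun P hPT ↦ (Ideal.span_singleton_le_iff_mem _).mpr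
      (hzero P.2 ((Submodule.mem_iInf _).mp hx ⟨P, hPT⟩))
  simpa using hle hT

/-- Distinct minimal primes generated by idempotents are coprime. -/
lemma isCoprime_of_mem_minimalPrimes_of_isIdempotentElem {A : Type*} [CommRing A]
    {P Q : Ideal A} (hP : P ∈ minimalPrimes A) (hQ : Q ∈ minimalPrimes A) (hne : P ≠ Q)
    {e : A} (he : IsIdempotentElem e) (hPe : P = Ideal.span {1 - e}) : IsCoprime P Q := by
  have h1e : 1 - e ∈ P := hPe ▸ Ideal.mem_span_singleton_self (1 - e)
  rcases hQ.1.1.mem_or_mem (x := 1 - e) (y := e)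
    (by rw [sub_mul, one_mul, he.eq, sub_self]; exact Q.zero_mem) with h | h
  · have hPQ : P ≤ Q := hPe ▸ (Ideal.span_singleton_le_iff_mem _).mpr h
    exact absurd (le_antisymm hPQ (hQ.2 hP.1 hPQ)) hne
  · exact Ideal.isCoprime_iff_exists.mpr ⟨1 - e, h1e, e, h, by ring⟩

/-- A semi-hereditary commutative ring in which every minimal prime is finitely
generated is isomorphic to a finite product of Prüfer domains (domains all of
whose finitely generated ideals are projective). -/
theorem stmt_12 (A : Type u) [CommRing A]
    (hsh : ∀ I : Ideal A, I.FG → Module.Projective A I)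
    (hmin : ∀ P ∈ minimalPrimes A, P.FG) :
    ∃ (n : ℕ) (I : Fin n → Ideal A),
      Nonempty (A ≃+* ((i : Fin n) → A ⧸ I i)) ∧
        ∀ i : Fin n, IsDomain (A ⧸ I i) ∧
          ∀ J : Ideal (A ⧸ I i), J.FG → Module.Projective (A ⧸ I i) J := by
  have hidem : ∀ P ∈ minimalPrimes A, ∃ e : A, IsIdempotentElem e ∧ P = Ideal.span {1 - e} :=
    fun P hP ↦ exists_isIdempotentElem_of_mem_minimalPrimes
      (fun a ↦ hsh _ (Submodule.fg_span_singleton a)) hP (hmin P hP)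
  obtain ⟨T, hT⟩ := exists_finset_minimalPrimes_iInf_eq_bot hidem
  let I : Fin T.card → Ideal A := fun i ↦ (T.equivFin.symm i : minimalPrimes A)
  have hI (i) : I i ∈ minimalPrimes A := (T.equivFin.symm i : minimalPrimes A).2
  have hinj : Function.Injective I := Subtype.val_injective.comp
    (Subtype.val_injective.comp T.equivFin.symm.injective)
  have hbot : ⨅ i, I i = ⊥ :=
    (T.equivFin.symm.iInf_comp (g := fun P : T ↦ ((P : minimalPrimes A) : Ideal A))).trans hT
  have hcop : Pairwise (Function.onFun IsCoprime I) := fun i j hij ↦ by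
    obtain ⟨e, he, hPe⟩ := hidem _ (hI i)
    exact isCoprime_of_mem_minimalPrimes_of_isIdempotentElem (hI i) (hI j) (hinj.ne hij) he hPe
  refine ⟨T.card, I, ⟨((RingEquiv.quotientBot A).symm.trans
    (Ideal.quotEquivOfEq hbot.symm)).trans (Ideal.quotientInfRingEquivPiQuotient I hcop)⟩,
    fun i ↦ ?_⟩
  have := (hI i).1.1
  obtain ⟨e, he, hPe⟩ := hidem _ (hI i)
  refine ⟨inferInstance, ?_⟩
  rw [hPe]
  exact projective_ideal_quotient_of_isIdempotentElem hsh he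
end

section
/- Let k be a field, let m = (x,y) be the maximal ideal of k[x,y] generated by the variables, and let A = k[x,y]_m/(x², xy). Then A has exactly two prime ideals, namely P = (x) and m = (x,y), the total quotient ring Q(A) equals A, and Q(A) has Krull dimension 1, while for every prime ideal Q of A and every torsion-free A-module M, the localization M_Q is a torsion-free A_Q-module (because every non-zero-divisor of A_Q is a unit). -/
theorem mul_eq_zero_of_mem_span_pair {A : Type*} [CommRing A] {x y a : A}
    (hxx : x * x = 0) (hxy : x * y = 0)
    (ha : a ∈ Ideal.span {x, y}) : a * x = 0 := by
  obtain ⟨c, d, rfl⟩ := Ideal.mem_span_pair.mp ha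
  linear_combination c * hxx + d * hxy

section LocalRing

variable {A : Type*} [CommRing A] [IsLocalRing A] {x y : A}

theorem exists_isUnit_sub_mul_pow_mem_span [IsNoetherianRing A]
    (hm : IsLocalRing.maximalIdeal A = Ideal.span {x, y}) {a : A} (ha : a ∉ Ideal.span {x}) :
    ∃ (n : ℕ) (u : A), IsUnit u ∧ a - u * y ^ n ∈ Ideal.span {x} := by
  have hxm : Ideal.span {x} ≤ IsLocalRing.maximalIdeal A := by
    rw [hm]; exact Ideal.span_mono (by simp)
  have hym : y ∈ IsLocalRing.maximalIdeal A := by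
    rw [hm]; exact Ideal.subset_span (by simp)
  have hne : Ideal.span {x} ≠ ⊤ := fun h =>
    (IsLocalRing.maximalIdeal.isMaximal A).ne_top (top_le_iff.mp (h ▸ hxm))
  have : Nontrivial (A ⧸ Ideal.span {x}) := Ideal.Quotient.nontrivial_iff.mpr hne
  have : IsLocalRing (A ⧸ Ideal.span {x}) :=
    IsLocalRing.of_surjective' (Ideal.Quotient.mk _) Ideal.Quotient.mk_surjective
  have hI : Ideal.span {Ideal.Quotient.mk (Ideal.span {x}) y} ≠ ⊤ := by
    intro h
    rw [Ideal.eq_top_iff_one, Ideal.mem_span_singleton] at h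
    obtain ⟨b, hb⟩ := h
    obtain ⟨b, rfl⟩ := Ideal.Quotient.mk_surjective b
    rw [← map_mul, ← map_one (Ideal.Quotient.mk _), Ideal.Quotient.eq] at hb
    refine (IsLocalRing.maximalIdeal.isMaximal A).ne_top ((Ideal.eq_top_iff_one _).mpr ?_)
    simpa using Ideal.add_mem _ (hxm hb) (Ideal.mul_mem_right b _ hym)
  have hexists : ∃ n, ¬ Ideal.Quotient.mk (Ideal.span {x}) y ^ n ∣
      Ideal.Quotient.mk (Ideal.span {x}) a := by
    by_contra! h
    refine ha (Ideal.Quotient.eq_zero_iff_mem.mp ?_)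
    rw [← Ideal.mem_bot, ← Ideal.iInf_pow_eq_bot_of_isLocalRing _ hI, Ideal.mem_iInf]
    intro n
    rw [Ideal.span_singleton_pow, Ideal.mem_span_singleton]
    exact h n
  classical
  obtain ⟨n, hn⟩ : ∃ n, Nat.find hexists = n + 1 := by
    refine Nat.exists_eq_succ_of_ne_zero fun h => Nat.find_spec hexists ?_
    simp [h]
  have hdvd := Nat.find_min hexists (m := n) (by omega)
  have hndvd := Nat.find_spec hexists
  rw [hn] at hndvd
  obtain ⟨u, hu⟩ := not_not.mp hdvd
  obtain ⟨u, rfl⟩ := Ideal.Quotient.mk_surjective u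
  refine ⟨n, u, ?_, ?_⟩
  · by_contra h
    rw [← mem_nonunits_iff, ← IsLocalRing.mem_maximalIdeal, hm, Ideal.mem_span_pair] at h
    obtain ⟨c, d, rfl⟩ := h
    refine hndvd ⟨Ideal.Quotient.mk _ d, ?_⟩
    have hx : Ideal.Quotient.mk (Ideal.span {x}) x = 0 :=
      Ideal.Quotient.eq_zero_iff_mem.mpr (Ideal.mem_span_singleton_self x)
    rw [hu, map_add, map_mul, map_mul, hx]
    ring
  · rw [← Ideal.Quotient.eq, hu, map_mul, map_pow, mul_comm]

theorem isPrime_span_singleton_of_pow_notMem [IsNoetherianRing A]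
    (hm : IsLocalRing.maximalIdeal A = Ideal.span {x, y})
    (hy : ∀ n : ℕ, y ^ n ∉ Ideal.span {x}) : (Ideal.span {x}).IsPrime := by
  refine ⟨fun h => hy 0 (h ▸ Submodule.mem_top), fun {a b} hab => ?_⟩
  by_contra! h
  obtain ⟨n, u, hu, hau⟩ := exists_isUnit_sub_mul_pow_mem_span hm h.1
  obtain ⟨l, v, hv, hbv⟩ := exists_isUnit_sub_mul_pow_mem_span hm h.2
  refine hy (n + l) ((Ideal.unit_mul_mem_iff_mem _ (hu.mul hv)).mp ?_)
  have := Ideal.sub_mem _ hab (Ideal.add_mem _ (Ideal.mul_mem_right b _ hau)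
    (Ideal.mul_mem_left _ (u * y ^ n) hbv))
  convert this using 1
  ring

theorem isPrime_iff_eq_span_singleton_or_eq_span_pair [IsNoetherianRing A]
    (hm : IsLocalRing.maximalIdeal A = Ideal.span {x, y}) (hxx : x * x = 0)
    (hy : ∀ n : ℕ, y ^ n ∉ Ideal.span {x}) (Q : Ideal A) :
    Q.IsPrime ↔ Q = Ideal.span {x} ∨ Q = Ideal.span {x, y} := by
  constructor
  · intro hQ
    have hxQ : x ∈ Q := by
      rcases hQ.mem_or_mem (hxx ▸ Q.zero_mem : x * x ∈ Q) with h | h <;> exact h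
    have hle : Ideal.span {x} ≤ Q := (Ideal.span_singleton_le_iff_mem _).mpr hxQ
    rw [or_iff_not_imp_left]
    intro hne
    obtain ⟨a, haQ, ha⟩ := Set.not_subset.mp fun h => hne (le_antisymm h hle)
    obtain ⟨n, u, hu, hau⟩ := exists_isUnit_sub_mul_pow_mem_span hm ha
    have hyQ : y ∈ Q := by
      refine hQ.mem_of_pow_mem n ((Ideal.unit_mul_mem_iff_mem _ hu).mp ?_)
      simpa using Ideal.sub_mem _ haQ (hle hau)
    refine le_antisymm (hm ▸ IsLocalRing.le_maximalIdeal hQ.ne_top) ?_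
    rw [Ideal.span_le, Set.insert_subset_iff, Set.singleton_subset_iff]
    exact ⟨hxQ, hyQ⟩
  · rintro (rfl | rfl)
    · exact isPrime_span_singleton_of_pow_notMem hm hy
    · exact hm ▸ (IsLocalRing.maximalIdeal.isMaximal A).isPrime

theorem isUnit_of_mem_nonZeroDivisors_of_maximalIdeal_eq_span_pair
    (hm : IsLocalRing.maximalIdeal A = Ideal.span {x, y}) (hxx : x * x = 0) (hxy : x * y = 0)
    (hx : x ≠ 0) {a : A} (ha : a ∈ nonZeroDivisors A) : IsUnit a := by
  by_contra h
  rw [← mem_nonunits_iff, ← IsLocalRing.mem_maximalIdeal, hm] at h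
  exact hx ((mem_nonZeroDivisors_iff.mp ha).1 x (mul_eq_zero_of_mem_span_pair hxx hxy h))

theorem ringKrullDim_eq_one_of_isPrime_iff
    (hprime : ∀ Q : Ideal A, Q.IsPrime ↔ Q = Ideal.span {x} ∨ Q = Ideal.span {x, y})
    (hne : Ideal.span {x} ≠ Ideal.span {x, y}) : ringKrullDim A = 1 := by
  have hle : Ideal.span {x} ≤ Ideal.span {x, y} := Ideal.span_mono (by simp)
  apply le_antisymm
  · have : Ring.KrullDimLE 1 A := by
      refine Ring.krullDimLE_one_iff.mpr fun I hI => ?_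
      rcases (hprime I).mp hI with rfl | rfl
      · left
        refine ⟨⟨hI, bot_le⟩, fun q hq _ => ?_⟩
        rcases (hprime q).mp hq.1 with rfl | rfl
        exacts [le_rfl, hle]
      · right
        have hmax := IsLocalRing.maximalIdeal.isMaximal A
        rcases (hprime _).mp hmax.isPrime with h | h
        · exact absurd (le_antisymm hle (h ▸ IsLocalRing.le_maximalIdeal hI.ne_top)) hne
        · exact h ▸ hmax
    exact (Ring.krullDimLE_iff (n := 1)).mp this
  · have hlt : (⟨Ideal.span {x}, (hprime _).mpr (.inl rfl)⟩ : PrimeSpectrum A) <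
        ⟨Ideal.span {x, y}, (hprime _).mpr (.inr rfl)⟩ :=
      lt_of_le_of_ne hle fun h => hne (congrArg PrimeSpectrum.asIdeal h)
    exact Order.one_le_krullDim_iff.mpr ⟨_, _, hlt⟩

theorem isUnit_of_mem_nonZeroDivisors_localizationAtPrime
    (hm : IsLocalRing.maximalIdeal A = Ideal.span {x, y}) (hxx : x * x = 0) (hxy : x * y = 0)
    (hx : x ≠ 0)
    (hprime : ∀ Q : Ideal A, Q.IsPrime ↔ Q = Ideal.span {x} ∨ Q = Ideal.span {x, y})
    (hne : Ideal.span {x} ≠ Ideal.span {x, y}) (Q : Ideal A) [hQ : Q.IsPrime]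
    {a : Localization.AtPrime Q} (ha : a ∈ nonZeroDivisors (Localization.AtPrime Q)) :
    IsUnit a := by
  obtain ⟨r, s, rfl⟩ := IsLocalization.exists_mk'_eq Q.primeCompl a
  by_cases hr : r ∈ Q
  · exfalso
    rcases (hprime Q).mp hQ with rfl | rfl
    · have hy : y ∉ Ideal.span {x} := by
        intro hy
        refine hne (le_antisymm (Ideal.span_mono (by simp)) ?_)
        rw [Ideal.span_le, Set.insert_subset_iff, Set.singleton_subset_iff]
        exact ⟨Ideal.mem_span_singleton_self x, hy⟩
      refine nonZeroDivisors.ne_zero ha ?_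
      rw [IsLocalization.mk'_eq_zero_iff]
      obtain ⟨c, rfl⟩ := Ideal.mem_span_singleton.mp hr
      exact ⟨⟨y, hy⟩, by linear_combination c * hxy⟩
    · have h0 : algebraMap A (Localization.AtPrime (Ideal.span {x, y})) x = 0 := by
        refine (mem_nonZeroDivisors_iff.mp ha).1 _ ?_
        rw [mul_comm, IsLocalization.mul_mk'_eq_mk'_of_mul, mul_comm,
          mul_eq_zero_of_mem_span_pair hxx hxy hr, IsLocalization.mk'_zero]
      obtain ⟨t, ht⟩ := (IsLocalization.map_eq_zero_iff
        (Ideal.span {x, y}).primeCompl _ _).mp h0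
      have htu : IsUnit (t : A) := by
        by_contra h
        rw [← mem_nonunits_iff, ← IsLocalRing.mem_maximalIdeal, hm] at h
        exact t.2 h
      exact hx (htu.mul_right_eq_zero.mp ht)
  · exact (IsLocalization.AtPrime.isUnit_mk'_iff _ Q r s).mpr hr

end LocalRing

namespace MvPolynomial

theorem sub_C_constantCoeff_mem_span_X_pair {R : Type*} [CommRing R]
    (p : MvPolynomial (Fin 2) R) : p - C (constantCoeff p) ∈ Ideal.span {X 0, X 1} := by
  let I : Ideal (MvPolynomial (Fin 2) R) := Ideal.span {X 0, X 1}
  have h : Ideal.Quotient.mk I = (Ideal.Quotient.mk I).comp (C.comp constantCoeff) := by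
    refine ringHom_ext (by simp) fun i => ?_
    simp only [RingHom.comp_apply, constantCoeff_X, map_zero]
    refine Ideal.Quotient.eq_zero_iff_mem.mpr (Ideal.subset_span ?_)
    fin_cases i <;> simp
  exact Ideal.Quotient.eq.mp (RingHom.congr_fun h p)

/-- Two elements of the maximal ideal of a local `k`-algebra `B` satisfying `b² = bc = 0` define a
homomorphism from `k[x,y]_{(x,y)}/(x², xy)` to `B`. -/
theorem exists_ringHom_quotient_localization {k : Type*} [Field k]
    {m : Ideal (MvPolynomial (Fin 2) k)} (hm : m = Ideal.span {X 0, X 1}) [m.IsPrime]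
    {J : Ideal (Localization.AtPrime m)}
    (hJ : J = Ideal.span
      {algebraMap (MvPolynomial (Fin 2) k) (Localization.AtPrime m) (X 0 ^ 2),
       algebraMap (MvPolynomial (Fin 2) k) (Localization.AtPrime m) (X 0 * X 1)})
    {B : Type*} [CommRing B] [Algebra k B] [IsLocalRing B] {b c : B}
    (hb : b ∈ IsLocalRing.maximalIdeal B) (hc : c ∈ IsLocalRing.maximalIdeal B)
    (hbb : b ^ 2 = 0) (hbc : b * c = 0) :
    ∃ f : Localization.AtPrime m ⧸ J →+* B,
      f (Ideal.Quotient.mk J (algebraMap (MvPolynomial (Fin 2) k) _ (X 0))) = b ∧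
      f (Ideal.Quotient.mk J (algebraMap (MvPolynomial (Fin 2) k) _ (X 1))) = c := by
  have hunit (s : m.primeCompl) : IsUnit ((aeval ![b, c] : _ →ₐ[k] B).toRingHom s) := by
    have hs : (s : MvPolynomial (Fin 2) k) - C (constantCoeff (s : MvPolynomial (Fin 2) k)) ∈
        Ideal.span {X 0, X 1} := sub_C_constantCoeff_mem_span_X_pair _
    have hs0 : constantCoeff (s : MvPolynomial (Fin 2) k) ≠ 0 := by
      intro h
      rw [h, map_zero, sub_zero, ← hm] at hs
      exact s.2 hs
    obtain ⟨p, q, hpq⟩ := Ideal.mem_span_pair.mp hs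
    rw [eq_sub_iff_add_eq] at hpq
    by_contra h
    rw [← mem_nonunits_iff, ← IsLocalRing.mem_maximalIdeal, ← hpq] at h
    simp only [AlgHom.toRingHom_eq_coe, RingHom.coe_coe, map_add, map_mul, aeval_X,
      Matrix.cons_val_zero, Matrix.cons_val_one, aeval_C] at h
    rw [Ideal.add_mem_iff_right _ (Ideal.add_mem _ (Ideal.mul_mem_left _ _ hb)
      (Ideal.mul_mem_left _ _ hc)), IsLocalRing.mem_maximalIdeal, mem_nonunits_iff] at h
    exact h ((Ne.isUnit hs0).map (algebraMap k B))
  have hker : J ≤ RingHom.ker (IsLocalization.lift hunit : Localization.AtPrime m →+* B) := by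
    rw [hJ, Ideal.span_le, Set.insert_subset_iff, Set.singleton_subset_iff]
    simp only [SetLike.mem_coe, RingHom.mem_ker, IsLocalization.lift_eq]
    simp [hbb, hbc]
  refine ⟨Ideal.Quotient.lift J (IsLocalization.lift hunit) fun z hz =>
    RingHom.mem_ker.mp (hker hz), ?_, ?_⟩
  · rw [Ideal.Quotient.lift_mk, IsLocalization.lift_eq]
    exact aeval_X _ _
  · rw [Ideal.Quotient.lift_mk, IsLocalization.lift_eq]
    exact aeval_X _ _

end MvPolynomial

universe u v

open MvPolynomial in
/-- Let `A = k[x,y]_{(x,y)}/(x², xy)` (presented as any ring isomorphic to this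
quotient).  Then: the prime ideals of `A` are exactly `P = (x)` and `m = (x,y)`,
which are distinct; the natural map from `A` to its total quotient ring `Q(A)` is
an isomorphism; `Q(A)` has Krull dimension `1`; and for every prime ideal `Q` of
`A`, every non-zero-divisor of `A_Q` is a unit and the localization at `Q` of any
torsion-free `A`-module is a torsion-free `A_Q`-module. -/
theorem stmt_18 (k : Type u) [Field k]
    (m : Ideal (MvPolynomial (Fin 2) k))
    (hm : m = Ideal.span {X 0, X 1}) [m.IsPrime]
    (J : Ideal (Localization.AtPrime m))
    (hJ : J = Ideal.span
      {algebraMap (MvPolynomial (Fin 2) k) (Localization.AtPrime m) (X 0 ^ 2),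
       algebraMap (MvPolynomial (Fin 2) k) (Localization.AtPrime m) (X 0 * X 1)})
    (A : Type u) [CommRing A] (eA : A ≃+* Localization.AtPrime m ⧸ J)
    (x' y' : A)
    (hx : eA x' = Ideal.Quotient.mk J
      (algebraMap (MvPolynomial (Fin 2) k) (Localization.AtPrime m) (X 0)))
    (hy : eA y' = Ideal.Quotient.mk J
      (algebraMap (MvPolynomial (Fin 2) k) (Localization.AtPrime m) (X 1))) :
    (∀ Q : Ideal A, Q.IsPrime ↔ Q = Ideal.span {x'} ∨ Q = Ideal.span {x', y'}) ∧
    Ideal.span {x'} ≠ Ideal.span {x', y'} ∧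
    Function.Bijective (algebraMap A (Localization (nonZeroDivisors A))) ∧
    ringKrullDim (Localization (nonZeroDivisors A)) = 1 ∧
    (∀ (Q : Ideal A) [Q.IsPrime],
      (∀ a ∈ nonZeroDivisors (Localization.AtPrime Q), IsUnit a) ∧
      (∀ (M : Type v) [AddCommGroup M] [Module A M],
        (∀ a ∈ nonZeroDivisors A, Function.Injective fun z : M => a • z) →
          ∀ a ∈ nonZeroDivisors (Localization.AtPrime Q),
            Function.Injective
              fun z : LocalizedModule Q.primeCompl M => a • z)) := by
  have := isNoetherianRing_of_ringEquiv _ eA.symm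
  have hJle : J ≤ IsLocalRing.maximalIdeal _ := by
    have h0 : algebraMap (MvPolynomial (Fin 2) k) (Localization.AtPrime m) (X 0) ∈
        IsLocalRing.maximalIdeal _ :=
      (IsLocalization.AtPrime.to_map_mem_maximal_iff _ m _).mpr
        (hm ▸ Ideal.subset_span (by simp))
    rw [hJ, Ideal.span_le, Set.insert_subset_iff, Set.singleton_subset_iff, pow_two, map_mul,
      map_mul]
    exact ⟨Ideal.mul_mem_right _ _ h0, Ideal.mul_mem_right _ _ h0⟩
  have : Nontrivial (Localization.AtPrime m ⧸ J) := Ideal.Quotient.nontrivial_iff.mpr fun h =>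
    (IsLocalRing.maximalIdeal.isMaximal (Localization.AtPrime m)).ne_top
      (top_le_iff.mp (h ▸ hJle))
  let π : Localization.AtPrime m →+* A :=
    (eA.symm : _ →+* A).comp (Ideal.Quotient.mk J)
  have hπ : Function.Surjective π := eA.symm.surjective.comp Ideal.Quotient.mk_surjective
  have hπx : π (algebraMap (MvPolynomial (Fin 2) k) _ (X 0)) = x' := by simp [π, ← hx]
  have hπy : π (algebraMap (MvPolynomial (Fin 2) k) _ (X 1)) = y' := by simp [π, ← hy]
  have hπJ {z} (hz : z ∈ J) : π z = 0 := by simp [π, Ideal.Quotient.eq_zero_iff_mem.mpr hz]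
  have : Nontrivial A := eA.symm.injective.nontrivial
  have : IsLocalRing A := IsLocalRing.of_surjective' π hπ
  have hmax : IsLocalRing.maximalIdeal A = Ideal.span {x', y'} := by
    rw [← IsLocalRing.map_maximalIdeal_of_surjective π hπ,
      ← Localization.AtPrime.map_eq_maximalIdeal, Ideal.map_map]
    refine (congrArg (Ideal.map _) hm).trans ?_
    rw [Ideal.map_span, Set.image_pair, ← hπx, ← hπy]
    rfl
  have hxx : x' * x' = 0 := by
    rw [← hπx, ← map_mul, ← map_mul, ← pow_two]
    exact hπJ (hJ ▸ Ideal.subset_span (by simp))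
  have hxy : x' * y' = 0 := by
    rw [← hπx, ← hπy, ← map_mul, ← map_mul]
    exact hπJ (hJ ▸ Ideal.subset_span (by simp))
  have hx0 : x' ≠ 0 := by
    have hε : (DualNumber.eps : DualNumber k) ∈ IsLocalRing.maximalIdeal (DualNumber k) := by
      rw [IsLocalRing.mem_maximalIdeal, mem_nonunits_iff, TrivSqZeroExt.isUnit_iff_isUnit_fst]
      simp
    obtain ⟨f, hf, -⟩ := 
      MvPolynomial.exists_ringHom_quotient_localization hm hJ hε (Ideal.zero_mem _)
      (by rw [pow_two, DualNumber.eps_mul_eps]) (mul_zero _)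
    rintro rfl
    rw [← hx, map_zero, map_zero] at hf
    simpa using congrArg TrivSqZeroExt.snd hf
  have hyn (n : ℕ) : y' ^ n ∉ Ideal.span {x'} := by
    have ht : (PowerSeries.X : PowerSeries k) ∈ IsLocalRing.maximalIdeal (PowerSeries k) := by
      rw [IsLocalRing.mem_maximalIdeal, mem_nonunits_iff]
      exact PowerSeries.X_prime.not_isUnit
    obtain ⟨f, hf, hf'⟩ := 
      MvPolynomial.exists_ringHom_quotient_localization hm hJ (Ideal.zero_mem _) ht
      (by simp) (zero_mul _)
    intro h
    obtain ⟨c, hc⟩ := Ideal.mem_span_singleton.mp h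
    have := congrArg (fun z => f (eA z)) hc
    simp only [map_pow, map_mul, hx, hy, hf, hf', zero_mul] at this
    exact pow_ne_zero n PowerSeries.X_ne_zero this
  have hprime := isPrime_iff_eq_span_singleton_or_eq_span_pair hmax hxx hyn
  have hne : Ideal.span {x'} ≠ Ideal.span {x', y'} := by
    intro h
    apply hyn 1
    rw [h, pow_one]
    exact Ideal.subset_span (by simp)
  have hunits : nonZeroDivisors A ≤ IsUnit.submonoid A := fun a ha =>
    isUnit_of_mem_nonZeroDivisors_of_maximalIdeal_eq_span_pair hmax hxx hxy hx0 ha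
  have hloc (Q : Ideal A) [Q.IsPrime] (a) (ha : a ∈ nonZeroDivisors (Localization.AtPrime Q)) :
      IsUnit a :=
    isUnit_of_mem_nonZeroDivisors_localizationAtPrime hmax hxx hxy hx0 hprime hne Q ha
  refine ⟨hprime, hne, (IsLocalization.atUnits A _ hunits).bijective, ?_, fun Q _ =>
    ⟨hloc Q, fun M _ _ _ a ha z w hzw => (hloc Q a ha).smul_left_cancel.mp hzw⟩⟩
  rw [← ringKrullDim_eq_of_ringEquiv
    (IsLocalization.atUnits A (nonZeroDivisors A) (S := Localization _) hunits).toRingEquiv]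
  exact ringKrullDim_eq_one_of_isPrime_iff hprime hne
end
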